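/- For each n, throw m = m(n) balls independently of each other into n boxes, each ball landing in each box with probability 1/n, and for j ≥ 0 let Z_{mn}^{(j)} be the number of boxes containing exactly j balls. Suppose λ_n := m(n)/n → λ for some λ > 0. Then for every fixed J ≥ 0, the random vector (n^{-1/2}(Z_{mn}^{(j)} − n π_{λ_n}(j)))_{j=0}^{J} converges in distribution to a centered Gaussian vector (X̃^{(0)},…,X̃^{(J)}) with covariances Cov(X̃^{(i)}, X̃^{(j)}) = δ_{ij} π_λ(i) − π_λ(i) π_λ(j) (1 + (i−λ)(j−λ)/λ). -/

import Mathlib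

open MeasureTheory ProbabilityTheory Filter Topology

noncomputable section

/-- Convergence in distribution (weak convergence of laws): integrals of every bounded
continuous function converge. -/
def TendstoInDistribution {E : Type*} [MeasurableSpace E] [TopologicalSpace E]
    (μs : ℕ → Measure E) (μ : Measure E) : Prop :=
  ∀ f : BoundedContinuousFunction E ℝ,
    Tendsto (fun n => ∫ x, f x ∂(μs n)) atTop (𝓝 (∫ x, f x ∂μ))

/-- `κ` is a version of the conditional distribution of the first coordinate given the
second coordinate, for the joint law `μ`: it is a Markov kernel which disintegrates `μ`. -/
def IsCondLaw {E F : Type*} [MeasurableSpace E] [MeasurableSpace F]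
    (μ : Measure (E × F)) (κ : Kernel F E) : Prop :=
  IsMarkovKernel κ ∧
  ∀ s : Set E, ∀ t : Set F, MeasurableSet s → MeasurableSet t →
    μ (s ×ˢ t) = ∫⁻ z in t, κ z s ∂(μ.map Prod.snd)

/-- A family of measures `κ z` (conditional distributions) is stochastically increasing:
`P(X ≤ x | Y = z)` is weakly decreasing in `z`. -/
def StochIncrFam {E F : Type*} [MeasurableSpace E] [Preorder E] [Preorder F]
    (κ : F → Measure E) : Prop :=
  ∀ z₁ z₂ : F, z₁ ≤ z₂ → ∀ x : E, κ z₂ {w | w ≤ x} ≤ κ z₁ {w | w ≤ x}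

/-- A family of measures `κ z` is stochastically decreasing: `P(X ≥ x | Y = z)` is weakly
decreasing in `z` (equivalently, `-X` is stochastically increasing). -/
def StochDecrFam {E F : Type*} [MeasurableSpace E] [Preorder E] [Preorder F]
    (κ : F → Measure E) : Prop :=
  ∀ z₁ z₂ : F, z₁ ≤ z₂ → ∀ x : E, κ z₂ {w | x ≤ w} ≤ κ z₁ {w | x ≤ w}

/-- Covariance of two real functionals under a measure. -/
def covFn {E : Type*} [MeasurableSpace E] (μ : Measure E) (f g : E → ℝ) : ℝ :=
  ∫ x, f x * g x ∂μ - (∫ x, f x ∂μ) * (∫ x, g x ∂μ)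

/-- A measure on a real normed space is Gaussian (jointly normal, possibly degenerate) if
every continuous linear functional pushes it forward to a one-dimensional Gaussian law. -/
def IsGaussianMeasure {E : Type*} [NormedAddCommGroup E] [NormedSpace ℝ E]
    [MeasurableSpace E] (μ : Measure E) : Prop :=
  ∀ L : E →L[ℝ] ℝ, ∃ m : ℝ, ∃ v : NNReal, μ.map (fun x => L x) = gaussianReal m v

open scoped ENNReal

/-- The uniform probability measure on `Fin m → Fin n`: `m` balls thrown independently
and uniformly into `n` boxes. -/
def uniformFin (n m : ℕ) : Measure (Fin m → Fin n) :=
  (Fintype.card (Fin m → Fin n) : ℝ≥0∞)⁻¹ • Measure.count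

/-- The number of boxes containing exactly `j` balls in the allocation `ω`. -/
def boxesWith (n m : ℕ) (j : ℕ) (ω : Fin m → Fin n) : ℕ :=
  (Finset.univ.filter fun b : Fin n =>
    (Finset.univ.filter fun i : Fin m => ω i = b).card = j).card

/-- The Poisson point probabilities `π_λ(k) = e^{-λ} λ^k / k!`. -/
def poissonProb (lam : ℝ) (k : ℕ) : ℝ :=
  Real.exp (-lam) * lam ^ k / (k.factorial : ℝ)

/-- The number of balls in box `b`. -/
def occ {n m : ℕ} (ω : Fin m → Fin n) (b : Fin n) : ℕ :=
  (Finset.univ.filter fun i : Fin m => ω i = b).card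

lemma sum_occ_eq (n m : ℕ) (F : (Fin n → ℕ) → ℂ) :
    ∑ ω : Fin m → Fin n, F (occ ω) =
      ∑ k ∈ Finset.piAntidiag Finset.univ m, (Nat.multinomial Finset.univ k : ℂ) * F k := by
  let L := (MvPolynomial.basisMonomials (Fin n) ℂ).constr ℂ (fun k => F k)
  have hL : ∀ k : Fin n →₀ ℕ, L (MvPolynomial.monomial k 1) = F k := by
    intro k
    have := (MvPolynomial.basisMonomials (Fin n) ℂ).constr_basis ℂ (fun k => F k) k
    simpa [L] using this
  have h1 : (∑ b : Fin n, (MvPolynomial.X b : MvPolynomial (Fin n) ℂ)) ^ m =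
      ∑ ω : Fin m → Fin n, MvPolynomial.monomial (∑ i, Finsupp.single (ω i) 1) 1 := by
    rw [Fintype.sum_pow]
    refine Finset.sum_congr rfl fun ω _ => ?_
    rw [MvPolynomial.monomial_sum_one]
    rfl
  have h2 := Finset.sum_pow_eq_sum_piAntidiag (Finset.univ : Finset (Fin n))
    (fun b => (MvPolynomial.X b : MvPolynomial (Fin n) ℂ)) m
  rw [h1] at h2
  have h3 := congrArg L h2
  rw [map_sum, map_sum] at h3
  convert h3 using 1
  · refine Finset.sum_congr rfl fun ω _ => ?_
    rw [hL]
    congr 1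
    ext b
    simp [occ, Finsupp.finsetSum_apply, Finsupp.single_apply]
  · refine Finset.sum_congr rfl fun k _ => ?_
    have : (∏ b : Fin n, (MvPolynomial.X b : MvPolynomial (Fin n) ℂ) ^ k b) =
        MvPolynomial.monomial (Finsupp.equivFunOnFinite.symm k) 1 := by
      rw [MvPolynomial.monomial_eq]
      simp [Finsupp.prod_fintype]
    rw [this, ← nsmul_eq_mul, ← nsmul_eq_mul, map_nsmul, hL]
    simp

lemma integral_exp_int (k : ℤ) :
    ∫ θ in (-Real.pi)..Real.pi, Complex.exp (θ * k * Complex.I) = if k = 0 then 2 * Real.pi else 0 := by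
  split_ifs with h
  · simp [h]; ring
  · have hc : (k * Complex.I : ℂ) ≠ 0 := by simp [h]
    have := integral_exp_mul_complex (a := -Real.pi) (b := Real.pi) hc
    have e : ∀ θ : ℝ, Complex.exp (θ * k * Complex.I) = Complex.exp (k * Complex.I * θ) := by
      intro θ; congr 1; ring
    simp_rw [e]
    rw [this]
    have : Complex.exp (k * Complex.I * Real.pi) = Complex.exp (k * Complex.I * (-Real.pi : ℝ)) := by
      rw [Complex.exp_eq_exp_iff_exists_int]
      exact ⟨k, by push_cast; ring⟩
    rw [this]; simp

/-- Poisson expectation of `g(X) e^{iθX}`. -/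
def Phi (r : NNReal) (g : ℕ → ℂ) (θ : ℝ) : ℂ :=
  ∫ k, g k * Complex.exp (θ * k * Complex.I) ∂(poissonMeasure r)

lemma fourier_poisson (n m : ℕ) (r : NNReal) (g : ℕ → ℂ) (hg : ∀ k, ‖g k‖ ≤ 1) :
    ∫ θ in (-Real.pi)..Real.pi, (Phi r g θ) ^ n * Complex.exp (-(θ * m * Complex.I)) =
      (2 * Real.pi * (Real.exp (-r) ^ n * r ^ m / m.factorial : ℝ) : ℂ) *
        ∑ ω : Fin m → Fin n, ∏ b, g (occ ω b) := by
  set μ := Measure.pi (fun _ : Fin n => poissonMeasure r) with hμ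
  let H : (Fin n → ℕ) → ℝ → ℂ := fun k θ =>
    (∏ b, g (k b)) * Complex.exp (θ * (((∑ b, (k b : ℤ)) - m : ℤ) : ℂ) * Complex.I)
  have hH : ∀ θ, (Phi r g θ) ^ n * Complex.exp (-(θ * m * Complex.I)) = ∫ k, H k θ ∂μ := by
    intro θ
    have := integral_fintype_prod_eq_pow (ι := Fin n) (μ := poissonMeasure r)
      (fun k : ℕ => g k * Complex.exp (θ * k * Complex.I))
    rw [Fintype.card_fin] at this
    rw [Phi, ← this, ← integral_mul_const]
    congr 1
    ext k
    simp only [H]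
    rw [Finset.prod_mul_distrib, mul_assoc, ← Complex.exp_sum, ← Complex.exp_add]
    congr 2
    push_cast
    rw [← Finset.sum_mul, ← Finset.mul_sum]
    ring
  have hmeas : Measurable (Function.uncurry H) := by
    refine measurable_from_prod_countable_right fun k => ?_
    simp only [H, Function.uncurry]
    fun_prop
  have hnorm : ∀ k θ, ‖H k θ‖ ≤ 1 := by
    intro k θ
    simp only [H, norm_mul, norm_prod]
    have : ‖Complex.exp (θ * (((∑ b, (k b : ℤ)) - m : ℤ) : ℂ) * Complex.I)‖ = 1 := by
      have := Complex.norm_exp_ofReal_mul_I (θ * (((∑ b, (k b : ℤ)) - m : ℤ) : ℝ))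
      rw [← this]; push_cast; rfl
    rw [this, mul_one]
    exact Finset.prod_le_one (fun _ _ => norm_nonneg _) fun b _ => hg _
  simp_rw [hH]
  rw [intervalIntegral.integral_of_le (by linarith [Real.pi_pos]), integral_integral_swap]
  swap
  · refine Integrable.of_bound (C := 1) ?_ (ae_of_all _ fun x => hnorm _ _)
    exact (hmeas.comp measurable_swap).aestronglyMeasurable
  simp_rw [← intervalIntegral.integral_of_le (show -Real.pi ≤ Real.pi by linarith [Real.pi_pos])]
  have h4 : ∀ k, (∫ θ in (-Real.pi)..Real.pi, H k θ) =
      (↑(Finset.piAntidiag (Finset.univ : Finset (Fin n)) m) : Set (Fin n → ℕ)).indicator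
        (fun k => (∏ b, g (k b)) * (2 * Real.pi)) k := by
    intro k
    simp only [H]
    rw [intervalIntegral.integral_const_mul, integral_exp_int, Set.indicator_apply]
    have : (∑ b, (k b : ℤ)) - (m:ℤ) = 0 ↔ k ∈ (↑(Finset.piAntidiag (Finset.univ : Finset (Fin n)) m) : Set (Fin n → ℕ)) := by
      simp [sub_eq_zero]
      norm_cast
    simp only [this]
    split_ifs <;> simp
  simp_rw [h4]
  rw [integral_indicator (Finset.measurableSet _), setIntegral_finset,
    sum_occ_eq n m (fun k => ∏ b, g (k b)), Finset.mul_sum]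
  swap
  · exact IntegrableOn.finset
  refine Finset.sum_congr rfl fun k hk => ?_
  have hk' : ∑ b, k b = m := by simpa using hk
  have hs : μ.real {k} = Real.exp (-r) ^ n * r ^ m / ∏ b, ((k b).factorial : ℝ) := by
    rw [hμ, measureReal_def, Measure.pi_singleton, ENNReal.toReal_prod]
    simp_rw [← measureReal_def, poissonMeasure_real_singleton]
    rw [Finset.prod_div_distrib, Finset.prod_mul_distrib, Finset.prod_pow_eq_pow_sum, hk']
    simp
  have hsp : (∏ b, ((k b).factorial : ℝ)) * (Nat.multinomial Finset.univ k : ℝ) = m.factorial := by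
    have := Nat.multinomial_spec Finset.univ k
    rw [hk'] at this
    exact_mod_cast this
  have hne : (∏ b, ((k b).factorial : ℝ)) ≠ 0 := Finset.prod_ne_zero_iff.2 fun b _ => by positivity
  have hne2 : (m.factorial : ℝ) ≠ 0 := by positivity
  have : μ.real {k} = Real.exp (-r) ^ n * r ^ m / m.factorial * (Nat.multinomial Finset.univ k : ℝ) := by
    rw [hs, div_mul_eq_mul_div, div_eq_div_iff hne hne2, ← hsp]; ring
  rw [this, Complex.real_smul]
  push_cast
  ring

lemma poissonProb_nonneg {l : ℝ} (hl : 0 ≤ l) (k : ℕ) : 0 ≤ poissonProb l k := by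
  unfold poissonProb; positivity

lemma poissonProb_succ (l : ℝ) (k : ℕ) :
    poissonProb l (k + 1) * ((k + 1 : ℕ) : ℝ) = l * poissonProb l k := by
  unfold poissonProb
  rw [Nat.factorial_succ]
  push_cast
  have : ((k : ℝ) + 1) ≠ 0 := by positivity
  have : (k.factorial : ℝ) ≠ 0 := by positivity
  field_simp
  ring

lemma hasSum_of_eq {f g : ℕ → ℝ} {a b : ℝ} (h : HasSum f a) (hf : ∀ k, g k = f k) (hab : b = a) :
    HasSum g b := by
  rw [hab, show g = f from funext hf]; exact h

lemma hasSum_poisson_zero (l : ℝ) : HasSum (fun k => poissonProb l k) 1 := by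
  have h := (NormedSpace.expSeries_div_hasSum_exp l).mul_left (Real.exp (-l))
  rw [← Real.exp_eq_exp_ℝ, ← Real.exp_add] at h
  simpa [poissonProb, mul_div_assoc] using h

lemma hasSum_poisson_shift {l a : ℝ} {f : ℕ → ℝ} 
    (h : HasSum (fun k => poissonProb l k * f (k + 1)) a) :
    HasSum (fun k : ℕ => poissonProb l k * (k * f k)) (l * a) := by
  rw [← hasSum_nat_add_iff' 1]
  simp only [Finset.range_one, Finset.sum_singleton, Nat.cast_zero, zero_mul, mul_zero, sub_zero]
  refine (h.mul_left l).congr_fun ?_ 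
  intro k
  rw [← mul_assoc, poissonProb_succ]; ring

lemma hasSum_poisson_one (l : ℝ) : HasSum (fun k : ℕ => poissonProb l k * k) l := by
  have := hasSum_poisson_shift (l := l) (a := 1) (f := fun _ => 1) (by simpa using hasSum_poisson_zero l)
  simpa using this

lemma hasSum_poisson_two (l : ℝ) : HasSum (fun k : ℕ => poissonProb l k * (k : ℝ) ^ 2) (l ^ 2 + l) := by
  have := hasSum_poisson_shift (l := l) (a := l + 1) (f := fun k => k) (by
    simpa [mul_add] using (hasSum_poisson_one l).add (hasSum_poisson_zero l))
  convert this using 1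
  · ext k; ring
  · ring

/-- mean of `t` under Poisson. -/
def muT (J : ℕ) (t : ℕ → ℝ) (l : ℝ) : ℝ := ∑ j ∈ Finset.range (J + 1), poissonProb l j * t j

def bT (J : ℕ) (t : ℕ → ℝ) (l : ℝ) : ℝ :=
  ∑ j ∈ Finset.range (J + 1), poissonProb l j * (t j * (j - l))

def aT (J : ℕ) (t : ℕ → ℝ) (l : ℝ) : ℝ :=
  ∑ j ∈ Finset.range (J + 1), poissonProb l j * t j ^ 2 - muT J t l ^ 2

def YY (J : ℕ) (t : ℕ → ℝ) (l s : ℝ) (k : ℕ) : ℝ := t k - muT J t l + s * (k - l)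

lemma hasSum_fin {J : ℕ} {t : ℕ → ℝ} (ht : ∀ k, J < k → t k = 0) (f : ℕ → ℝ → ℝ)
    (hf : ∀ k, f k 0 = 0) :
    HasSum (fun k => f k (t k)) (∑ j ∈ Finset.range (J + 1), f j (t j)) := by
  refine hasSum_sum_of_ne_finset_zero fun b hb => ?_
  rw [ht b (by simpa using hb), hf]

lemma hasSum_YY_one {J : ℕ} {t : ℕ → ℝ} (ht : ∀ k, J < k → t k = 0) (l s : ℝ) :
    HasSum (fun k => poissonProb l k * YY J t l s k) 0 := by
  have h1 : HasSum (fun k => poissonProb l k * t k) (muT J t l) :=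
    hasSum_fin ht (fun k x => poissonProb l k * x) (by simp)
  have := (h1.sub ((hasSum_poisson_zero l).mul_left (muT J t l))).add
    (((hasSum_poisson_one l).sub ((hasSum_poisson_zero l).mul_left l)).mul_left s)
  refine hasSum_of_eq this (fun k => ?_) ?_
  · simp only [YY]; ring
  · ring

lemma hasSum_YY_two {J : ℕ} {t : ℕ → ℝ} (ht : ∀ k, J < k → t k = 0) (l s : ℝ) :
    HasSum (fun k => poissonProb l k * YY J t l s k ^ 2)
      (aT J t l + 2 * s * bT J t l + s ^ 2 * l) := by
  have h1 : HasSum (fun k => poissonProb l k * t k) (muT J t l) :=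
    hasSum_fin ht (fun k x => poissonProb l k * x) (by simp)
  have h2 := hasSum_fin ht (fun k x => poissonProb l k * x ^ 2) (by simp)
  have h3 : HasSum (fun k : ℕ => poissonProb l k * (t k * (k - l))) (bT J t l) :=
    hasSum_fin ht (fun k x => poissonProb l k * (x * (k - l))) (by simp)
  have h0 := hasSum_poisson_zero l
  have hk1 := hasSum_poisson_one l
  have hk2 := hasSum_poisson_two l
  have := (((((h2.sub (h1.mul_left (2 * muT J t l))).add (h0.mul_left (muT J t l ^ 2))).add
    (h3.mul_left (2 * s))).sub
    ((hk1.sub (h0.mul_left l)).mul_left (2 * s * muT J t l))).add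
    (((hk2.sub (hk1.mul_left (2 * l))).add (h0.mul_left (l ^ 2))).mul_left (s ^ 2)))
  refine hasSum_of_eq this (fun k => ?_) ?_
  · simp only [YY]; ring
  · simp only [aT]; ring

/-- `h(x) = e^{ix} - 1 - ix`. -/
lemma norm_h_le (x : ℝ) :
    ‖Complex.exp (x * Complex.I) - 1 - x * Complex.I‖ ≤ 3 * x ^ 2 := by
  have hn : ‖(x * Complex.I : ℂ)‖ = |x| := by simp
  rcases le_or_gt |x| 1 with h | h
  · have := Complex.norm_exp_sub_one_sub_id_le (x := x * Complex.I) (by rw [hn]; exact h)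
    rw [hn, sq_abs] at this
    nlinarith [sq_nonneg x]
  · calc _ ≤ ‖Complex.exp (x * Complex.I)‖ + ‖(1 : ℂ)‖ + ‖(x * Complex.I : ℂ)‖ :=
        (norm_sub_le _ _).trans (add_le_add_left (norm_sub_le _ _) _)
      _ = 2 + |x| := by rw [Complex.norm_exp_ofReal_mul_I, hn]; norm_num
      _ ≤ 3 * x ^ 2 := by rw [← sq_abs]; nlinarith

lemma tendsto_h {c y : ℕ → ℝ} {y0 : ℝ} (hc : Tendsto c atTop (𝓝 0)) (hc0 : ∀ᶠ n in atTop, c n ≠ 0)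
    (hy : Tendsto y atTop (𝓝 y0)) :
    Tendsto (fun n => ((c n : ℂ) ^ 2)⁻¹ * (Complex.exp ((c n * y n : ℝ) * Complex.I) - 1 -
      (c n * y n : ℝ) * Complex.I)) atTop (𝓝 (-(y0 : ℂ) ^ 2 / 2)) := by
  have h1 : Tendsto (fun n => -(y n : ℂ) ^ 2 / 2) atTop (𝓝 (-(y0 : ℂ) ^ 2 / 2)) := by
    have : Tendsto (fun n => (y n : ℂ)) atTop (𝓝 y0) :=
      (Complex.continuous_ofReal.tendsto _).comp hy
    exact ((this.pow 2).neg).div_const 2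
  have hx : Tendsto (fun n => c n * y n) atTop (𝓝 0) := by simpa using hc.mul hy
  have h2 : Tendsto (fun n => ((c n : ℂ) ^ 2)⁻¹ * (Complex.exp ((c n * y n : ℝ) * Complex.I) - 1 -
      (c n * y n : ℝ) * Complex.I) - (-(y n : ℂ) ^ 2 / 2)) atTop (𝓝 0) := by
    have hb : Tendsto (fun n => |c n| * |y n| ^ 3) atTop (𝓝 0) := by
      simpa using hc.abs.mul (hy.abs.pow 3)
    refine squeeze_zero_norm' ?_ hb
    filter_upwards [hc0, hx.abs.eventually (eventually_le_nhds (show |(0:ℝ)| < 1 by simp))] with n hn hn1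
    have hcn : (c n : ℂ) ≠ 0 := by exact_mod_cast hn
    have key := Complex.exp_bound (x := (c n * y n : ℝ) * Complex.I) (by simpa using hn1)
      (n := 3) (by norm_num)
    have e : ((c n : ℂ) ^ 2)⁻¹ * (Complex.exp ((c n * y n : ℝ) * Complex.I) - 1 -
      (c n * y n : ℝ) * Complex.I) - (-(y n : ℂ) ^ 2 / 2) = ((c n : ℂ) ^ 2)⁻¹ *
      (Complex.exp ((c n * y n : ℝ) * Complex.I) - ∑ m ∈ Finset.range 3,
        (((c n * y n : ℝ) : ℂ) * Complex.I) ^ m / (m.factorial : ℂ)) := by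
      simp only [Finset.sum_range_succ, Finset.range_zero, Finset.sum_empty, mul_pow, Complex.I_sq]
      push_cast
      field_simp
      simp
      ring
    rw [e, norm_mul]
    have e2 : ‖(((c n * y n : ℝ) : ℂ) * Complex.I)‖ = |c n| * |y n| := by simp
    rw [e2] at key
    have e3 : ‖((c n : ℂ) ^ 2)⁻¹‖ = (|c n| ^ 2)⁻¹ := by simp
    rw [e3]
    have hp : 0 < |c n| := abs_pos.2 hn
    rw [inv_mul_le_iff₀ (by positivity)]
    refine key.trans ?_
    have : (0:ℝ) ≤ (|c n| * |y n|) ^ 3 := by positivity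
    calc _ ≤ (|c n| * |y n|) ^ 3 * 1 := by
          refine mul_le_mul_of_nonneg_left ?_ this
          norm_num [Nat.factorial]
      _ = _ := by ring
  have := h2.add h1
  simpa using this

/-- Poisson expectation of `e^{i c y(X)}`. -/
def Psi (l c : ℝ) (y : ℕ → ℝ) : ℂ :=
  ∑' k, (poissonProb l k : ℂ) * Complex.exp ((c * y k : ℝ) * Complex.I)

lemma summable_Psi {l : ℝ} (hl : 0 ≤ l) (c : ℝ) (y : ℕ → ℝ) :
    Summable fun k => (poissonProb l k : ℂ) * Complex.exp ((c * y k : ℝ) * Complex.I) := by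
  refine Summable.of_norm_bounded (hasSum_poisson_zero l).summable fun k => ?_
  rw [norm_mul, Complex.norm_exp_ofReal_mul_I, Complex.norm_real, mul_one, Real.norm_eq_abs,
    abs_of_nonneg (poissonProb_nonneg hl k)]

lemma poissonProb_le {l L : ℝ} (hl : 0 ≤ l) (h : l ≤ L) (k : ℕ) :
    poissonProb l k ≤ Real.exp L * poissonProb L k := by
  unfold poissonProb
  rw [mul_div_assoc, mul_div_assoc, ← mul_assoc, ← Real.exp_add, add_neg_cancel, Real.exp_zero]
  have : Real.exp (-l) ≤ 1 := Real.exp_le_one_iff.2 (by linarith)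
  gcongr

lemma continuous_poissonProb (k : ℕ) : Continuous fun l => poissonProb l k := by
  unfold poissonProb; fun_prop

lemma continuous_muT (J : ℕ) (t : ℕ → ℝ) : Continuous fun l => muT J t l := by
  unfold muT
  exact continuous_finsetSum _ fun j _ => (continuous_poissonProb j).mul continuous_const

lemma Psi_sub_one {l : ℝ} (hl : 0 ≤ l) (c : ℝ) {y : ℕ → ℝ}
    (hy : HasSum (fun k => poissonProb l k * y k) 0) :
    Psi l c y - 1 = ∑' k, (poissonProb l k : ℂ) * (Complex.exp ((c * y k : ℝ) * Complex.I) - 1 -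
      (c * y k : ℝ) * Complex.I) := by
  have h1 := (summable_Psi hl c y).hasSum
  have h2 : HasSum (fun k => (poissonProb l k : ℂ)) ((1 : ℝ) : ℂ) :=
    Complex.hasSum_ofReal.2 (hasSum_poisson_zero l)
  have h3 : HasSum (fun k => ((poissonProb l k * y k : ℝ) : ℂ)) ((0 : ℝ) : ℂ) :=
    Complex.hasSum_ofReal.2 hy
  have := (h1.sub h2).sub (h3.mul_left (c * Complex.I))
  rw [Psi]
  have h4 := this.tsum_eq
  rw [Complex.ofReal_zero, mul_zero, sub_zero, Complex.ofReal_one] at h4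
  rw [← h4]
  congr 1
  ext k
  push_cast
  ring

lemma tendsto_Psi_pow {J : ℕ} {t : ℕ → ℝ} (ht : ∀ k, J < k → t k = 0) {l : ℕ → ℝ} {lam : ℝ}
    (hl0 : ∀ n, 0 ≤ l n) (hl : Tendsto l atTop (𝓝 lam)) (s : ℝ) :
    Tendsto (fun n : ℕ => Psi (l n) (√n)⁻¹ (YY J t (l n) s) ^ n) atTop
      (𝓝 (Complex.exp (-((aT J t lam + 2 * s * bT J t lam + s ^ 2 * lam : ℝ) : ℂ) / 2))) := by
  have hlam : 0 ≤ lam := ge_of_tendsto' hl hl0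
  have hc : Tendsto (fun n : ℕ => (√(n:ℝ))⁻¹) atTop (𝓝 0) :=
    tendsto_inv_atTop_zero.comp (Real.tendsto_sqrt_atTop.comp tendsto_natCast_atTop_atTop)
  have hc0 : ∀ᶠ n : ℕ in atTop, (√(n:ℝ))⁻¹ ≠ 0 := by
    filter_upwards [eventually_gt_atTop 0] with n hn
    positivity
  have hmu : Tendsto (fun n => muT J t (l n)) atTop (𝓝 (muT J t lam)) :=
    ((continuous_muT J t).tendsto _).comp hl
  have hy : ∀ k, Tendsto (fun n => YY J t (l n) s k) atTop (𝓝 (YY J t lam s k)) := by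
    intro k
    unfold YY
    exact (tendsto_const_nhds.sub hmu).add ((tendsto_const_nhds.sub hl).const_mul s)
  obtain ⟨T, hT⟩ : ∃ T, ∀ k, |t k| ≤ T := by
    refine ⟨∑ j ∈ Finset.range (J + 1), |t j|, fun k => ?_⟩
    by_cases hk : J < k
    · rw [ht k hk, abs_zero]; positivity
    · exact Finset.single_le_sum (f := fun j => |t j|) (fun _ _ => abs_nonneg _)
        (by simp; omega)
  set D := T + (|muT J t lam| + 1) + |s| * (lam + 1) with hD
  have hsum : Summable fun k : ℕ =>
      3 * (Real.exp (lam + 1) * poissonProb (lam + 1) k * (D + |s| * k) ^ 2) := by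
    have := ((((hasSum_poisson_zero (lam + 1)).mul_left (D ^ 2)).add
      ((hasSum_poisson_one (lam + 1)).mul_left (2 * D * |s|))).add
      ((hasSum_poisson_two (lam + 1)).mul_left (|s| ^ 2))).mul_left (3 * Real.exp (lam + 1))
    refine (hasSum_of_eq this (fun k => ?_) rfl).summable
    ring
  have main : Tendsto (fun n : ℕ => ∑' k, ((poissonProb (l n) k : ℂ) *
      ((((√(n:ℝ))⁻¹ : ℝ) : ℂ) ^ 2)⁻¹ *
      (Complex.exp (((√(n:ℝ))⁻¹ * YY J t (l n) s k : ℝ) * Complex.I) - 1 -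
      ((√(n:ℝ))⁻¹ * YY J t (l n) s k : ℝ) * Complex.I))) atTop
      (𝓝 (∑' k, (poissonProb lam k : ℂ) * (-(YY J t lam s k : ℂ) ^ 2 / 2))) := by
    refine tendsto_tsum_of_dominated_convergence hsum (fun k => ?_) ?_
    · simp_rw [mul_assoc]
      refine Tendsto.mul ?_ (tendsto_h hc hc0 (hy k))
      exact (Complex.continuous_ofReal.tendsto _).comp
        (((continuous_poissonProb k).tendsto _).comp hl)
    · have e1 : ∀ᶠ n in atTop, l n ≤ lam + 1 := hl.eventually (eventually_le_nhds (by linarith))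
      have e2 : ∀ᶠ n in atTop, |muT J t (l n)| ≤ |muT J t lam| + 1 :=
        hmu.abs.eventually (eventually_le_nhds (by linarith))
      filter_upwards [e1, e2, hc0] with n h1 h2 h3 k
      have hyb : |YY J t (l n) s k| ≤ D + |s| * k := by
        unfold YY
        have a1 := abs_add_le (t k - muT J t (l n)) (s * (k - l n))
        have a2 := abs_sub (t k) (muT J t (l n))
        have a3 : |s * (k - l n)| ≤ |s| * (k + (lam + 1)) := by
          rw [abs_mul]
          refine mul_le_mul_of_nonneg_left ?_ (abs_nonneg s)
          rw [abs_le]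
          have : (0:ℝ) ≤ k := Nat.cast_nonneg k
          constructor <;> linarith [hl0 n]
        have := hT k
        rw [hD]
        linarith
      have hcp : 0 < (√(n:ℝ))⁻¹ := lt_of_le_of_ne (by positivity) (Ne.symm h3)
      rw [norm_mul, norm_mul, Complex.norm_real, Real.norm_eq_abs,
        abs_of_nonneg (poissonProb_nonneg (hl0 n) k), norm_inv, norm_pow, Complex.norm_real,
        Real.norm_eq_abs, abs_of_pos hcp]
      have hh := norm_h_le ((√(n:ℝ))⁻¹ * YY J t (l n) s k)
      set c := (√(n:ℝ))⁻¹
      calc _ ≤ poissonProb (l n) k * (c ^ 2)⁻¹ * (3 * (c * YY J t (l n) s k) ^ 2) := by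
            refine mul_le_mul_of_nonneg_left hh ?_
            have := poissonProb_nonneg (hl0 n) k
            positivity
        _ = 3 * (poissonProb (l n) k * YY J t (l n) s k ^ 2) := by field_simp
        _ ≤ _ := by
            refine mul_le_mul_of_nonneg_left ?_ (by norm_num)
            refine mul_le_mul (poissonProb_le (hl0 n) h1 k) ?_ (sq_nonneg _) ?_
            · rw [← sq_abs]; gcongr
            · have := poissonProb_nonneg (show 0 ≤ lam + 1 by linarith) k
              positivity
  have hlim : (∑' k, (poissonProb lam k : ℂ) * (-(YY J t lam s k : ℂ) ^ 2 / 2)) =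
      -((aT J t lam + 2 * s * bT J t lam + s ^ 2 * lam : ℝ) : ℂ) / 2 := by
    have := (Complex.hasSum_ofReal.2 (hasSum_YY_two ht lam s)).mul_left (-(1/2 : ℂ))
    rw [show -((aT J t lam + 2 * s * bT J t lam + s ^ 2 * lam : ℝ) : ℂ) / 2 =
      -(1/2 : ℂ) * ((aT J t lam + 2 * s * bT J t lam + s ^ 2 * lam : ℝ) : ℂ) by ring, ← this.tsum_eq]
    congr 1
    ext k
    push_cast
    ring
  rw [hlim] at main
  have : Tendsto (fun n : ℕ => (n : ℂ) * (Psi (l n) (√n)⁻¹ (YY J t (l n) s) - 1)) atTop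
      (𝓝 (-((aT J t lam + 2 * s * bT J t lam + s ^ 2 * lam : ℝ) : ℂ) / 2)) := by
    refine main.congr fun n => ?_
    rw [Psi_sub_one (hl0 n) _ (hasSum_YY_one ht (l n) s), ← tsum_mul_left]
    congr 1
    ext k
    have : ((((√(n:ℝ))⁻¹ : ℝ) : ℂ) ^ 2)⁻¹ = (n : ℂ) := by
      rw [← Complex.ofReal_pow, inv_pow, Real.sq_sqrt (Nat.cast_nonneg n)]
      simp
    rw [this]; ring
  have := Complex.tendsto_one_add_pow_exp_of_tendsto this
  simpa using this

lemma norm_one_add_exp_le {θ : ℝ} (h : |θ| ≤ Real.pi) :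
    ‖1 + Complex.exp (θ * Complex.I)‖ ≤ 2 - θ ^ 2 / Real.pi ^ 2 := by
  have e : 1 + Complex.exp (θ * Complex.I) =
      Complex.exp ((θ / 2 : ℝ) * Complex.I) * ((2 * Real.cos (θ / 2) : ℝ) : ℂ) := by
    push_cast
    rw [Complex.cos, mul_div_cancel₀ _ (by norm_num), mul_add, ← Complex.exp_add, ← Complex.exp_add]
    rw [add_comm]
    congr 1
    · congr 1; ring
    · rw [← Complex.exp_zero]; congr 1; ring
  rw [abs_le] at h
  have hcos : 0 ≤ Real.cos (θ / 2) :=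
    Real.cos_nonneg_of_mem_Icc ⟨by linarith, by linarith⟩
  rw [e, norm_mul, Complex.norm_exp_ofReal_mul_I, Complex.norm_real, one_mul, Real.norm_eq_abs,
    abs_of_nonneg (by positivity)]
  have := Real.cos_le_one_sub_mul_cos_sq (x := θ / 2) (by rw [abs_le]; constructor <;> linarith)
  calc _ ≤ 2 * (1 - 2 / Real.pi ^ 2 * (θ / 2) ^ 2) := by linarith
    _ = _ := by ring

lemma norm_Psi_le {l : ℝ} (hl : 0 ≤ l) {c s γ : ℝ} {y : ℕ → ℝ} {K : ℕ} (hy : y (K + 1) - y K = s)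
    (hγ0 : 0 ≤ γ) (h1 : γ ≤ poissonProb l K) (h2 : γ ≤ poissonProb l (K + 1))
    (hθ : |c * s| ≤ Real.pi) :
    ‖Psi l c y‖ ≤ 1 - γ * ((c * s) ^ 2 / Real.pi ^ 2) := by
  let e : ℕ → ℂ := fun k => Complex.exp ((c * y k : ℝ) * Complex.I)
  have hen : ∀ k, ‖e k‖ = 1 := fun k => Complex.norm_exp_ofReal_mul_I _
  let w : ℕ → ℝ := fun k => if k = K ∨ k = K + 1 then γ else 0
  have hw : HasSum w (2 * γ) := by
    have := hasSum_sum_of_ne_finset_zero (f := w) (s := {K, K + 1}) (L := .unconditional ℕ) (fun b hb => by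
      simp only [Finset.mem_insert, Finset.mem_singleton] at hb
      simp [w, hb])
    rw [Finset.sum_pair (by omega)] at this
    simpa [w, two_mul] using this
  have hwe : HasSum (fun k => (w k : ℂ) * e k) (γ * (e K + e (K + 1))) := by
    have := hasSum_sum_of_ne_finset_zero (f := fun k => (w k : ℂ) * e k) (s := {K, K + 1}) (L := .unconditional ℕ) (fun b hb => by
      simp only [Finset.mem_insert, Finset.mem_singleton] at hb
      simp [w, hb])
    rw [Finset.sum_pair (by omega)] at this
    simpa [w, mul_add] using this
  have hP := (summable_Psi hl c y).hasSum
  have hd := hP.sub hwe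
  have hwle : ∀ k, 0 ≤ poissonProb l k - w k := by
    intro k
    simp only [w]
    split_ifs with h
    · rcases h with rfl | rfl <;> linarith
    · simpa using poissonProb_nonneg hl k
  have hb : ‖Psi l c y - γ * (e K + e (K + 1))‖ ≤ 1 - 2 * γ := by
    have hd2 := (hasSum_poisson_zero l).sub hw
    refine (hd.tsum_eq.symm ▸ tsum_of_norm_bounded hd2 fun k => ?_ :)
    have : (poissonProb l k : ℂ) * Complex.exp ((c * y k : ℝ) * Complex.I) - (w k : ℂ) * e k =
        ((poissonProb l k - w k : ℝ) : ℂ) * e k := by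
      simp only [e]; push_cast; ring
    rw [this, norm_mul, hen, Complex.norm_real, mul_one, Real.norm_eq_abs, abs_of_nonneg (hwle k)]
  have he : e K + e (K + 1) = e K * (1 + Complex.exp ((c * s : ℝ) * Complex.I)) := by
    simp only [e]
    rw [mul_add, mul_one, ← Complex.exp_add, ← hy]
    congr 2
    push_cast; ring
  have h3 : ‖(γ : ℂ) * (e K + e (K + 1))‖ ≤ γ * (2 - (c * s) ^ 2 / Real.pi ^ 2) := by
    rw [he, norm_mul, norm_mul, hen, one_mul, Complex.norm_real, Real.norm_eq_abs, abs_of_nonneg hγ0]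
    exact mul_le_mul_of_nonneg_left (norm_one_add_exp_le hθ) hγ0
  have := norm_le_norm_add_norm_sub' (Psi l c y) (γ * (e K + e (K + 1)))
  linarith

lemma continuous_Psi {J : ℕ} {t : ℕ → ℝ} {l : ℝ} (hl : 0 ≤ l) (c : ℝ) :
    Continuous fun s => Psi l c (YY J t l s) := by
  unfold Psi
  refine continuous_tsum (u := fun k => poissonProb l k) (fun k => ?_) (hasSum_poisson_zero l).summable
    fun k s => ?_
  · unfold YY; fun_prop
  · rw [norm_mul, Complex.norm_exp_ofReal_mul_I, Complex.norm_real, mul_one, Real.norm_eq_abs,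
      abs_of_nonneg (poissonProb_nonneg hl k)]

lemma tendsto_integral_Psi {J : ℕ} {t : ℕ → ℝ} (ht : ∀ k, J < k → t k = 0) {l : ℕ → ℝ} {lam : ℝ}
    (hl0 : ∀ n, 0 ≤ l n) (hlam : 0 < lam) (hl : Tendsto l atTop (𝓝 lam)) :
    Tendsto (fun n : ℕ => ∫ s in (-(Real.pi * √n))..(Real.pi * √n),
        Psi (l n) (√n)⁻¹ (YY J t (l n) s) ^ n) atTop
      (𝓝 (∫ s : ℝ, Complex.exp (-((aT J t lam + 2 * s * bT J t lam + s ^ 2 * lam : ℝ) : ℂ) / 2))) := by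
  have hle : ∀ n : ℕ, -(Real.pi * √n) ≤ Real.pi * √n := fun n => by
    have : 0 ≤ Real.pi * √n := by positivity
    linarith
  have hI : ∀ n : ℕ, (∫ s in (-(Real.pi * √n))..(Real.pi * √n),
        Psi (l n) (√n)⁻¹ (YY J t (l n) s) ^ n) =
      ∫ s, (Set.Ioc (-(Real.pi * √n)) (Real.pi * √n)).indicator
        (fun s => Psi (l n) (√n)⁻¹ (YY J t (l n) s) ^ n) s := fun n => by
    rw [intervalIntegral.integral_of_le (hle n), integral_indicator measurableSet_Ioc]
  simp_rw [hI]
  set γ := min (poissonProb lam (J + 1)) (poissonProb lam (J + 2)) / 2 with hγ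
  have hp : ∀ k, 0 < poissonProb lam k := fun k => by unfold poissonProb; positivity
  have hγ0 : 0 < γ := by
    have := lt_min (hp (J + 1)) (hp (J + 2)); positivity
  have hev : ∀ k, γ < poissonProb lam k → ∀ᶠ n in atTop, γ ≤ poissonProb (l n) k := fun k hk =>
    (((continuous_poissonProb k).tendsto _).comp hl).eventually (eventually_ge_nhds hk)
  have g1 : γ < poissonProb lam (J + 1) := by
    have := min_le_left (poissonProb lam (J + 1)) (poissonProb lam (J + 2))
    have := hp (J + 1)
    rw [hγ]; linarith
  have g2 : γ < poissonProb lam (J + 2) := by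
    have := min_le_right (poissonProb lam (J + 1)) (poissonProb lam (J + 2))
    have := hp (J + 2)
    rw [hγ]; linarith
  refine tendsto_integral_filter_of_dominated_convergence
    (fun s => Real.exp (-(γ / Real.pi ^ 2) * s ^ 2)) ?_ ?_ (integrable_exp_neg_mul_sq (by positivity)) ?_
  · refine Eventually.of_forall fun n => ?_
    exact (((continuous_Psi (hl0 n) _).pow n).aestronglyMeasurable).indicator measurableSet_Ioc
  · filter_upwards [hev _ g1, hev _ g2, eventually_gt_atTop 0] with n h1 h2 hn
    refine ae_of_all _ fun s => ?_
    by_cases hs : s ∈ Set.Ioc (-(Real.pi * √n)) (Real.pi * √n)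
    swap
    · rw [Set.indicator_of_notMem hs, norm_zero]; positivity
    rw [Set.indicator_of_mem hs, norm_pow]
    have hn' : (0:ℝ) < n := by exact_mod_cast hn
    have hsq : 0 < √(n:ℝ) := Real.sqrt_pos.2 hn'
    have hθ : |(√(n:ℝ))⁻¹ * s| ≤ Real.pi := by
      rw [abs_mul, abs_of_pos (by positivity), inv_mul_le_iff₀ hsq, abs_le]
      constructor <;> linarith [hs.1, hs.2]
    have hb := norm_Psi_le (hl0 n) (c := (√(n:ℝ))⁻¹) (s := s) (γ := γ) (y := YY J t (l n) s) (K := J + 1)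
      (by
        unfold YY
        rw [ht (J + 1) (by omega), ht (J + 1 + 1) (by omega)]; push_cast; ring) hγ0.le h1 h2 hθ
    calc _ ≤ Real.exp (-(γ * (((√(n:ℝ))⁻¹ * s) ^ 2 / Real.pi ^ 2))) ^ n := by
          refine pow_le_pow_left₀ (norm_nonneg _) (hb.trans ?_) n
          have := Real.add_one_le_exp (-(γ * (((√(n:ℝ))⁻¹ * s) ^ 2 / Real.pi ^ 2)))
          linarith
      _ = _ := by
          rw [← Real.exp_nat_mul, mul_pow, inv_pow, Real.sq_sqrt hn'.le]
          congr 1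
          field_simp
  · refine ae_of_all _ fun s => ?_
    refine (tendsto_Psi_pow ht hl0 hl s).congr' ?_
    have : Tendsto (fun n : ℕ => Real.pi * √(n:ℝ)) atTop atTop :=
      (Real.tendsto_sqrt_atTop.comp tendsto_natCast_atTop_atTop).const_mul_atTop Real.pi_pos
    filter_upwards [this.eventually_gt_atTop |s|] with n hn
    rw [Set.indicator_of_mem]
    rw [abs_lt] at hn
    exact ⟨hn.1, hn.2.le⟩

lemma gauss_integral {lam : ℝ} (hlam : 0 < lam) (a b : ℝ) :
    (∫ s : ℝ, Complex.exp (-((a + 2 * s * b + s ^ 2 * lam : ℝ) : ℂ) / 2)) =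
      Complex.exp (-((a - b ^ 2 / lam : ℝ) : ℂ) / 2) *
      ∫ s : ℝ, Complex.exp (-((s ^ 2 * lam : ℝ) : ℂ) / 2) := by
  rw [← integral_add_right_eq_self _ (-(b / lam)), ← integral_const_mul]
  congr 1
  ext s
  rw [← Complex.exp_add]
  congr 1
  rw [← Complex.ofReal_neg, ← Complex.ofReal_neg, ← Complex.ofReal_neg, ← add_div,
    ← Complex.ofReal_add]
  congr 2
  field_simp
  ring

lemma gauss_integral_ne {lam : ℝ} (hlam : 0 < lam) :
    (∫ s : ℝ, Complex.exp (-((s ^ 2 * lam : ℝ) : ℂ) / 2)) ≠ 0 := by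
  have h : ∀ s : ℝ, Complex.exp (-((s ^ 2 * lam : ℝ) : ℂ) / 2) =
      ((Real.exp (-(lam / 2) * s ^ 2) : ℝ) : ℂ) := by
    intro s
    push_cast
    congr 1
    ring
  simp_rw [h]
  rw [integral_complex_ofReal, integral_gaussian]
  have : 0 < Real.pi / (lam / 2) := by positivity
  exact_mod_cast (Real.sqrt_pos.2 this).ne'

/-- The (unnormalised) characteristic function sum. -/
def WS (J n m : ℕ) (t : ℕ → ℝ) : ℂ :=
  ∑ ω : Fin m → Fin n, ∏ b, Complex.exp
    (((√n)⁻¹ * (t (occ ω b) - muT J t ((m : ℝ) / n)) : ℝ) * Complex.I)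

lemma Psi_eq_Phi (J n m : ℕ) (hn : 0 < n) (t : ℕ → ℝ) (s : ℝ) :
    Psi ((m : ℝ) / n) (√n)⁻¹ (YY J t ((m : ℝ) / n) s) ^ n =
    (Phi ((m : NNReal) / n) (fun k => Complex.exp
      (((√n)⁻¹ * (t k - muT J t ((m : ℝ) / n)) : ℝ) * Complex.I)) (s / √n)) ^ n *
      Complex.exp (-((s / √n : ℝ) * m * Complex.I)) := by
  have hn' : (n : ℂ) ≠ 0 := by exact_mod_cast hn.ne'
  have e : Complex.exp (-((s / √n : ℝ) * m * Complex.I)) =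
      Complex.exp (-((s / √n : ℝ) * (m / n) * Complex.I)) ^ n := by
    rw [← Complex.exp_nat_mul]
    congr 1
    field_simp
  rw [e, ← mul_pow]
  congr 1
  rw [Phi, integral_poissonMeasure, Psi, ← tsum_mul_right]
  congr 1
  ext k
  rw [Complex.real_smul, mul_assoc, ← Complex.exp_add, ← Complex.exp_add]
  congr 2
  simp only [YY]
  push_cast
  ring

lemma integral_Psi_eq (J n m : ℕ) (hn : 0 < n) : ∃ C : ℂ, C ≠ 0 ∧ ∀ t : ℕ → ℝ,
    ∫ s in (-(Real.pi * √n))..(Real.pi * √n),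
        Psi ((m : ℝ) / n) (√n)⁻¹ (YY J t ((m : ℝ) / n) s) ^ n = C * WS J n m t := by
  set r : NNReal := (m : NNReal) / n with hr
  have hn' : (0 : ℝ) < n := by exact_mod_cast hn
  have hsq : 0 < √(n:ℝ) := Real.sqrt_pos.2 hn'
  refine ⟨√n * (2 * Real.pi * (Real.exp (-r) ^ n * r ^ m / m.factorial : ℝ) : ℂ), ?_, fun t => ?_⟩
  · have h1 : (r : ℝ) ^ m ≠ 0 := by
      rcases Nat.eq_zero_or_pos m with h | h
      · simp [h]
      · have : (0:ℝ) < m := by exact_mod_cast h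
        have : (0:ℝ) < r := by rw [hr]; push_cast; positivity
        positivity
    have h2 : (Real.exp (-r) ^ n * r ^ m / m.factorial : ℝ) ≠ 0 := by
      have : (m.factorial : ℝ) ≠ 0 := by positivity
      have := Real.exp_ne_zero (-r)
      positivity
    have h3 : ((√(n:ℝ) : ℝ) : ℂ) ≠ 0 := by exact_mod_cast hsq.ne'
    have h4 : (Real.pi : ℂ) ≠ 0 := by exact_mod_cast Real.pi_ne_zero
    have h5 : ((Real.exp (-r) ^ n * r ^ m / m.factorial : ℝ) : ℂ) ≠ 0 := by exact_mod_cast h2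
    exact mul_ne_zero h3 (mul_ne_zero (mul_ne_zero two_ne_zero h4) h5)
  · simp_rw [Psi_eq_Phi J n m hn t]
    have := intervalIntegral.integral_comp_div (a := -(Real.pi * √n)) (b := Real.pi * √n)
      (fun θ : ℝ => (Phi ((m : NNReal) / n) (fun k => Complex.exp
      (((√n)⁻¹ * (t k - muT J t ((m : ℝ) / n)) : ℝ) * Complex.I)) θ) ^ n *
      Complex.exp (-(θ * m * Complex.I))) hsq.ne'
    rw [this, neg_div, mul_div_cancel_right₀ _ hsq.ne', fourier_poisson n m _ _
      (fun k => (Complex.norm_exp_ofReal_mul_I _).le), Complex.real_smul, WS, ← hr]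
    ring

lemma WS_zero (J n m : ℕ) : WS J n m (fun _ => 0) = (n : ℂ) ^ m := by
  simp [WS, muT]

lemma tendsto_WS {J : ℕ} {t : ℕ → ℝ} (ht : ∀ k, J < k → t k = 0) {m : ℕ → ℕ} {lam : ℝ}
    (hlam : 0 < lam) (hm : Tendsto (fun n => (m n : ℝ) / n) atTop (𝓝 lam)) :
    Tendsto (fun n : ℕ => ((n : ℂ) ^ (m n))⁻¹ * WS J n (m n) t) atTop
      (𝓝 (Complex.exp (-((aT J t lam - bT J t lam ^ 2 / lam : ℝ) : ℂ) / 2))) := by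
  have h1 := tendsto_integral_Psi ht (l := fun n => (m n : ℝ) / n) (fun n => by positivity) hlam hm
  have h0 := tendsto_integral_Psi (J := J) (t := fun _ => 0) (fun _ _ => rfl)
    (l := fun n => (m n : ℝ) / n) (fun n => by positivity) hlam hm
  rw [gauss_integral hlam] at h1 h0
  have ha : aT J (fun _ => 0) lam = 0 := by simp [aT, muT]
  have hb : bT J (fun _ => 0) lam = 0 := by simp [bT]
  have hne := gauss_integral_ne hlam
  rw [ha, hb] at h0
  have h := h1.div h0 (by simpa using hne)
  have e : ∀ x y : ℂ, y ≠ 0 → x * y / (Complex.exp (-((0 - 0 ^ 2 / lam : ℝ) : ℂ) / 2) * y) = x := by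
    intro x y hy
    simp [hy]
  rw [e _ _ hne] at h
  refine h.congr' ?_
  filter_upwards [eventually_gt_atTop 0] with n hn
  obtain ⟨C, hC, hC'⟩ := integral_Psi_eq J n (m n) hn
  simp only [Pi.div_apply]
  rw [hC', hC', WS_zero, mul_div_mul_left _ _ hC]
  rw [div_eq_inv_mul]

/-- Extend a finite vector by zero. -/
def extT {J : ℕ} (x : Fin (J + 1) → ℝ) (k : ℕ) : ℝ := if h : k < J + 1 then x ⟨k, h⟩ else 0

lemma extT_zero {J : ℕ} (x : Fin (J + 1) → ℝ) (k : ℕ) (hk : J < k) : extT x k = 0 := by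
  simp [extT]; omega

lemma extT_coe {J : ℕ} (x : Fin (J + 1) → ℝ) (k : Fin (J + 1)) : extT x k = x k := by
  rw [extT, dif_pos k.2]

/-- The limiting covariance matrix. -/
def covM (J : ℕ) (lam : ℝ) : Matrix (Fin (J + 1)) (Fin (J + 1)) ℝ := fun i j =>
  (if i = j then 1 else 0) * poissonProb lam i -
    poissonProb lam i * poissonProb lam j * (1 + ((i : ℝ) - lam) * ((j : ℝ) - lam) / lam)

lemma muT_extT {J : ℕ} (x : Fin (J + 1) → ℝ) (l : ℝ) :
    muT J (extT x) l = ∑ j : Fin (J + 1), poissonProb l j * x j := by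
  rw [muT, Finset.sum_range]
  simp_rw [extT_coe]

lemma quad_eq {J : ℕ} (x : Fin (J + 1) → ℝ) (lam : ℝ) :
    dotProduct x (Matrix.mulVec (covM J lam) x) =
      aT J (extT x) lam - bT J (extT x) lam ^ 2 / lam := by
  rw [aT, muT_extT, bT, Finset.sum_range, Finset.sum_range]
  simp_rw [extT_coe]
  simp only [dotProduct, Matrix.mulVec, covM, Finset.mul_sum]
  have h : ∀ i j : Fin (J + 1), x i * (((if i = j then 1 else 0) * poissonProb lam i -
    poissonProb lam i * poissonProb lam j * (1 + ((i : ℝ) - lam) * ((j : ℝ) - lam) / lam)) * x j) =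
    (if i = j then poissonProb lam i * (x i * x j) else 0) -
      (poissonProb lam i * x i) * (poissonProb lam j * x j) -
      (poissonProb lam i * (x i * (i - lam))) * (poissonProb lam j * (x j * (j - lam))) / lam := by
    intro i j
    split_ifs <;> ring
  simp_rw [h, Finset.sum_sub_distrib]
  congr 1
  · congr 1
    · simp [sq]
    · rw [sq, Finset.sum_mul_sum]
  · rw [sq, Finset.sum_mul_sum, Finset.sum_div]
    simp_rw [Finset.sum_div]

lemma sum_occ {J n m : ℕ} (x : Fin (J + 1) → ℝ) (ω : Fin m → Fin n) :
    ∑ b, extT x (occ ω b) = ∑ j : Fin (J + 1), (boxesWith n m j ω : ℝ) * x j := by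
  have h : ∀ b, extT x (occ ω b) = ∑ j : Fin (J + 1), if occ ω b = (j : ℕ) then x j else 0 := by
    intro b
    by_cases hb : occ ω b < J + 1
    · rw [Finset.sum_eq_single ⟨occ ω b, hb⟩]
      · simp [extT, hb]
      · intro j _ hj
        rw [if_neg]
        intro h
        exact hj (Fin.ext h.symm)
      · simp
    · rw [extT, dif_neg hb, Finset.sum_eq_zero]
      intro j _
      rw [if_neg]
      have := j.2
      omega
  simp_rw [h]
  rw [Finset.sum_comm]
  refine Finset.sum_congr rfl fun j _ => ?_
  rw [← Finset.sum_filter, Finset.sum_const, nsmul_eq_mul]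
  rfl

/-- The normalised vector. -/
def vecZ (J n m : ℕ) (ω : Fin m → Fin n) (j : Fin (J + 1)) : ℝ :=
  (Real.sqrt n)⁻¹ * ((boxesWith n m j ω : ℝ) - n * poissonProb ((m : ℝ) / n) j)

lemma WS_eq {J n m : ℕ} (x : Fin (J + 1) → ℝ) :
    WS J n m (extT x) = ∑ ω : Fin m → Fin n,
      Complex.exp ((∑ j, vecZ J n m ω j * x j : ℝ) * Complex.I) := by
  unfold WS
  refine Finset.sum_congr rfl fun ω _ => ?_
  rw [← Complex.exp_sum, ← Finset.sum_mul, ← Complex.ofReal_sum]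
  congr 3
  rw [← Finset.mul_sum, Finset.sum_sub_distrib, sum_occ, muT_extT]
  simp only [Finset.sum_const, Finset.card_univ, Fintype.card_fin, nsmul_eq_mul, vecZ]
  rw [Finset.mul_sum, ← Finset.sum_sub_distrib, Finset.mul_sum]
  refine Finset.sum_congr rfl fun j _ => ?_
  ring

instance uniformFin_prob (n m : ℕ) : IsProbabilityMeasure (uniformFin (n + 1) m) := by
  constructor
  unfold uniformFin
  rw [Measure.smul_apply, Measure.count_univ, smul_eq_mul, ENat.card_eq_coe_fintype_card]
  have h : (Fintype.card (Fin m → Fin (n + 1))) ≠ 0 := Fintype.card_ne_zero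
  refine ENNReal.inv_mul_cancel ?_ ?_
  · exact_mod_cast h
  · exact ENNReal.natCast_ne_top _

lemma integral_uniformFin (n m : ℕ) (f : (Fin m → Fin (n + 1)) → ℂ) :
    ∫ ω, f ω ∂(uniformFin (n + 1) m) = (((n + 1 : ℕ) : ℂ) ^ m)⁻¹ * ∑ ω, f ω := by
  unfold uniformFin
  rw [integral_smul_measure, integral_count, Fintype.card_fun, Fintype.card_fin, Fintype.card_fin, ENNReal.toReal_inv,
    ENNReal.toReal_natCast, Complex.real_smul]
  push_cast
  rfl

lemma charFun_vecZ (J n m : ℕ) (x : EuclideanSpace ℝ (Fin (J + 1))) :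
    charFun ((uniformFin (n + 1) m).map (fun ω => WithLp.toLp 2 (vecZ J (n + 1) m ω))) x =
      (((n + 1 : ℕ) : ℂ) ^ m)⁻¹ * WS J (n + 1) m (extT x.ofLp) := by
  rw [charFun_apply, integral_map (Measurable.of_discrete).aemeasurable (by fun_prop), integral_uniformFin, WS_eq]
  congr 1
  refine Finset.sum_congr rfl fun ω _ => ?_
  simp [PiLp.inner_apply, mul_comm]

lemma covM_posSemidef (m : ℕ → ℕ) (lam : ℝ) (hlam : 0 < lam)
    (hm : Tendsto (fun n => (m n : ℝ) / n) atTop (𝓝 lam)) (J : ℕ) : (covM J lam).PosSemidef := by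
  refine Matrix.PosSemidef.of_dotProduct_mulVec_nonneg ?_ fun x => ?_
  · ext i j
    simp only [Matrix.conjTranspose_apply, covM, star_trivial]
    by_cases h : i = j
    · simp [h]
    · simp [h, Ne.symm h]; ring
  · have h := tendsto_WS (extT_zero x) hlam hm
    rw [← tendsto_add_atTop_iff_nat 1] at h
    have h2 := h.norm
    have h3 := le_of_tendsto' h2 (b := 1) (fun n => by
      rw [← charFun_vecZ J n (m (n + 1)) (WithLp.toLp 2 x)]
      have : IsProbabilityMeasure ((uniformFin (n + 1) (m (n + 1))).map
        (fun ω => WithLp.toLp 2 (vecZ J (n + 1) (m (n + 1)) ω))) :=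
        Measure.isProbabilityMeasure_map (Measurable.of_discrete).aemeasurable
      exact norm_charFun_le_one (μ := (uniformFin (n + 1) (m (n + 1))).map
        (fun ω => WithLp.toLp 2 (vecZ J (n + 1) (m (n + 1)) ω))) _)
    rw [Complex.norm_exp, Real.exp_le_one_iff] at h3
    rw [star_trivial, quad_eq]
    have : (-((aT J (extT x) lam - bT J (extT x) lam ^ 2 / lam : ℝ) : ℂ) / 2).re =
      -(aT J (extT x) lam - bT J (extT x) lam ^ 2 / lam) / 2 := by
      rw [← Complex.ofReal_neg]; norm_cast
    rw [this] at h3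
    linarith

/-- Joint asymptotic normality of the numbers of boxes containing exactly `j` balls,
`0 ≤ j ≤ J` (Example 3.1; Kolchin–Sevast'yanov–Chistyakov, Theorem II.2.3). -/
theorem boxesWith_joint_clt (m : ℕ → ℕ) (lam : ℝ) (hlam : 0 < lam)
    (hm : Tendsto (fun n => (m n : ℝ) / n) atTop (𝓝 lam)) (J : ℕ) :
    ∃ ν : Measure (Fin (J + 1) → ℝ),
      IsProbabilityMeasure ν ∧ IsGaussianMeasure ν ∧
      (∀ j, (∫ x, x j ∂ν) = 0) ∧
      (∀ i j : Fin (J + 1), covFn ν (fun x => x i) (fun x => x j) =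
        (if i = j then 1 else 0) * poissonProb lam i -
          poissonProb lam i * poissonProb lam j *
            (1 + ((i : ℝ) - lam) * ((j : ℝ) - lam) / lam)) ∧
      TendstoInDistribution
        (fun n => (uniformFin n (m n)).map
          (fun ω => fun j : Fin (J + 1) => (Real.sqrt n)⁻¹ *
            ((boxesWith n (m n) j ω : ℝ) - n * poissonProb ((m n : ℝ) / n) j)))
        ν := by
  have hS := covM_posSemidef m lam hlam hm J
  set G := multivariateGaussian (0 : EuclideanSpace ℝ (Fin (J + 1))) (covM J lam) with hG
  let q : EuclideanSpace ℝ (Fin (J + 1)) →L[ℝ] (Fin (J + 1) → ℝ) :=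
    (EuclideanSpace.equiv (Fin (J + 1)) ℝ : EuclideanSpace ℝ (Fin (J + 1)) →L[ℝ] (Fin (J + 1) → ℝ))
  have hq : ∀ x, q x = x.ofLp := fun x => rfl
  have hqm : Measurable q := q.continuous.measurable
  have hmem : ∀ i : Fin (J + 1), MemLp (fun x : EuclideanSpace ℝ (Fin (J + 1)) => x i) 2 G := by
    intro i
    exact IsGaussian.memLp_dual G (EuclideanSpace.proj i) 2 (by simp)
  have hmean : ∀ i : Fin (J + 1), ∫ x, x.ofLp i ∂G = 0 := by
    intro i
    have := (EuclideanSpace.proj (𝕜 := ℝ) i).integral_comp_comm (μ := G)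
      (φ := fun x : EuclideanSpace ℝ (Fin (J + 1)) => x) IsGaussian.integrable_fun_id
    rw [hG, integral_id_multivariateGaussian] at this
    simpa using this
  refine ⟨G.map q, Measure.isProbabilityMeasure_map hqm.aemeasurable, ?_, ?_, ?_, ?_⟩
  · intro L
    rw [Measure.map_map L.continuous.measurable hqm]
    exact ⟨_, _, IsGaussian.map_eq_gaussianReal (μ := G) (L.comp q)⟩
  · intro j
    rw [integral_map hqm.aemeasurable (Measurable.aestronglyMeasurable (by fun_prop))]
    exact hmean j
  · intro i j
    have h := covariance_eval_multivariateGaussian (μ := 0) hS i j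
    rw [← hG, covariance_eq_sub (hmem i) (hmem j)] at h
    unfold covFn
    rw [integral_map hqm.aemeasurable (Measurable.aestronglyMeasurable (by fun_prop)), integral_map hqm.aemeasurable (Measurable.aestronglyMeasurable (by fun_prop)),
      integral_map hqm.aemeasurable (Measurable.aestronglyMeasurable (by fun_prop))]
    exact h
  · intro f
    rw [← tendsto_add_atTop_iff_nat 1]
    let P : ℕ → ProbabilityMeasure (EuclideanSpace ℝ (Fin (J + 1))) := fun n =>
      ⟨(uniformFin (n + 1) (m (n + 1))).map
        (fun ω => WithLp.toLp 2 (vecZ J (n + 1) (m (n + 1)) ω)),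
        Measure.isProbabilityMeasure_map (Measurable.of_discrete).aemeasurable⟩
    let G' : ProbabilityMeasure (EuclideanSpace ℝ (Fin (J + 1))) := ⟨G, inferInstance⟩
    have hP : Tendsto P atTop (𝓝 G') := by
      refine ProbabilityMeasure.tendsto_of_tendsto_charFun fun x => ?_
      have h := tendsto_WS (extT_zero x.ofLp) hlam hm
      rw [← tendsto_add_atTop_iff_nat 1] at h
      have e : charFun (G' : Measure (EuclideanSpace ℝ (Fin (J + 1)))) x =
          Complex.exp (-((aT J (extT x.ofLp) lam - bT J (extT x.ofLp) lam ^ 2 / lam : ℝ) : ℂ) / 2) := by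
        change charFun G x = _
        rw [hG, charFun_multivariateGaussian hS, ← quad_eq]
        congr 1
        simp [neg_div]
      rw [e]
      refine h.congr fun n => ?_
      exact (charFun_vecZ J n (m (n + 1)) x).symm
    rw [ProbabilityMeasure.tendsto_iff_forall_integral_tendsto] at hP
    have h := hP (f.compContinuous ⟨q, q.continuous⟩)
    rw [integral_map hqm.aemeasurable f.continuous.measurable.aestronglyMeasurable]
    refine h.congr fun n => ?_
    change ∫ x, f (q x) ∂((uniformFin (n + 1) (m (n + 1))).map
      (fun ω => WithLp.toLp 2 (vecZ J (n + 1) (m (n + 1)) ω))) =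
      ∫ x, f x ∂((uniformFin (n + 1) (m (n + 1))).map (fun ω => vecZ J (n + 1) (m (n + 1)) ω))
    have hfq : Measurable fun x => f (q x) := (f.continuous.comp q.continuous).measurable
    rw [integral_map (Measurable.of_discrete).aemeasurable hfq.aestronglyMeasurable,
      integral_map (Measurable.of_discrete).aemeasurable
      f.continuous.measurable.aestronglyMeasurable]
    rfl
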